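/- Let D ⊂ ℝⁿ be a bounded open convex domain, let p(z) = inf{t > 0 : x + t⁻¹y ∈ D} for z = x + iy with x ∈ D, let D^ell = {z = x+iy ∈ ℂⁿ : x ∈ D, p(z)p(z̄) < 1} be the elliptic tube over D, and define u : D^ell → [0, π/4) by u(z) = (arctan p(z) + arctan p(z̄))/2. Then: u is locally Lipschitz; u(x+iy) = 0 if and only if y = 0; u is plurisubharmonic on D^ell; u is the maximal element of U(D, D^ell); and (dd^c u)^n = 0 on D^ell ∖ D. -/

import Mathlib

open Metric Filter Complex Set

variable (n : ℕ)

/-- The canonical inclusion `ℝⁿ ⊆ ℂⁿ`. -/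
def reC (x : Fin n → ℝ) : Fin n → ℂ := fun i => (x i : ℂ)

/-- Imaginary part `Im : ℂⁿ → ℝⁿ`. -/
def imPart (z : Fin n → ℂ) : Fin n → ℝ := fun i => (z i).im

/-- Real part `Re : ℂⁿ → ℝⁿ`. -/
def rePart (z : Fin n → ℂ) : Fin n → ℝ := fun i => (z i).re

/-- A function `u : ℂⁿ → ℝ` is *plurisubharmonic* on `Ω ⊆ ℂⁿ` if it is upper
semicontinuous on `Ω` and satisfies the sub-mean-value inequality on every closed disc
of every complex line contained in `Ω`. -/
def PlurisubharmonicOn (u : (Fin n → ℂ) → ℝ) (Ω : Set (Fin n → ℂ)) : Prop :=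
  UpperSemicontinuousOn u Ω ∧
    ∀ a b : Fin n → ℂ, ∀ c : ℂ, ∀ r : ℝ, 0 < r →
      (∀ ζ ∈ closedBall c r, a + ζ • b ∈ Ω) →
      u (a + c • b) ≤
        (2 * Real.pi)⁻¹ * ∫ θ in (0:ℝ)..(2 * Real.pi), u (a + circleMap c r θ • b)

/-- The class `𝒰(ℝⁿ ∩ X, X)`: plurisubharmonic functions `u : X → [0, π/4)` vanishing
at the real points of `X`. -/
def MemPSHU (X : Set (Fin n → ℂ)) (u : (Fin n → ℂ) → ℝ) : Prop :=
  PlurisubharmonicOn n u X ∧ (∀ z ∈ X, 0 ≤ u z ∧ u z < Real.pi / 4) ∧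
    ∀ x : Fin n → ℝ, reC n x ∈ X → u (reC n x) = 0

/-- `E_{u,X}(x, ξ)`: the infimum, over `C¹` curves `γ : (-ε, ε) → X` with `γ 0 = x` and
`γ' 0 = i·ξ`, of `limsup_{t→0⁺} u (γ t)/t` (computed in `EReal`). -/
noncomputable def EInf (X : Set (Fin n → ℂ)) (u : (Fin n → ℂ) → ℝ)
    (x ξ : Fin n → ℝ) : EReal :=
  sInf {L : EReal | ∃ ε : ℝ, 0 < ε ∧ ∃ γ : ℝ → Fin n → ℂ,
    ContDiffOn ℝ 1 γ (Set.Ioo (-ε) ε) ∧ (∀ t ∈ Set.Ioo (-ε) ε, γ t ∈ X) ∧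
    γ 0 = reC n x ∧ HasDerivAt γ (Complex.I • reC n ξ) 0 ∧
    L = limsup (fun t : ℝ => ((u (γ t) / t : ℝ) : EReal)) (nhdsWithin 0 (Set.Ioi 0))}

/-- `E_{ℝⁿ,X}(x, ξ) = sup_{u ∈ 𝒰} E_{u,X}(x, ξ)`. -/
noncomputable def ESup (X : Set (Fin n → ℂ)) (x ξ : Fin n → ℝ) : EReal :=
  ⨆ u ∈ {u : (Fin n → ℂ) → ℝ | MemPSHU n X u}, EInf n X u x ξ

/-- Componentwise complex conjugation on `ℂⁿ`. -/
def conjC (z : Fin n → ℂ) : Fin n → ℂ := fun i => (starRingEnd ℂ) (z i)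

/-- The Minkowski functional of `D` centered at `x`, evaluated at `y`:
`p = inf {t > 0 : x + t⁻¹ y ∈ D}`. -/
noncomputable def mink (D : Set (Fin n → ℝ)) (x y : Fin n → ℝ) : ℝ :=
  sInf {t : ℝ | 0 < t ∧ x + t⁻¹ • y ∈ D}

/-- `p(z)`: the Minkowski functional of `D` centered at `Re z` evaluated at `Im z`. -/
noncomputable def minkP (D : Set (Fin n → ℝ)) (z : Fin n → ℂ) : ℝ :=
  mink n D (rePart n z) (imPart n z)

/-- The *elliptic tube* over a convex set `D ⊆ ℝⁿ` (Lempert):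
`D^ell = {z = x + iy : x ∈ D, p(z)·p(z̄) < 1}`. -/
def ellTube (D : Set (Fin n → ℝ)) : Set (Fin n → ℂ) :=
  {z : Fin n → ℂ | rePart n z ∈ D ∧ minkP n D z * minkP n D (conjC n z) < 1}

/-- The candidate maximal function on the elliptic tube:
`u(z) = (arctan p(z) + arctan p(z̄)) / 2`. -/
noncomputable def ellTubeU (D : Set (Fin n → ℝ)) (z : Fin n → ℂ) : ℝ :=
  (Real.arctan (minkP n D z) + Real.arctan (minkP n D (conjC n z))) / 2

/-- For a locally bounded plurisubharmonic function `u`, the homogeneous complex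
Monge–Ampère equation `(dd^c u)^n = 0` on an open set `Ω ⊆ ℂⁿ`, in the sense of
Bedford–Taylor, holds if and only if `u` is a *maximal* plurisubharmonic function on
`Ω` (Bedford–Taylor, Sadullaev); we take this equivalent characterization as the
definition. -/
def MongeAmpereZeroOn (u : (Fin n → ℂ) → ℝ) (Ω : Set (Fin n → ℂ)) : Prop :=
  ∀ G : Set (Fin n → ℂ), IsOpen G → closure G ⊆ Ω → IsCompact (closure G) →
    ∀ v : (Fin n → ℂ) → ℝ, PlurisubharmonicOn n v G →
      (∀ q ∈ frontier G,
        limsup (fun x => (v x : EReal)) (nhdsWithin q G) ≤ (u q : EReal)) →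
      ∀ q ∈ G, v q ≤ u q


section aux1
open Real Topology

lemma aux_mean_re {F : ℂ → ℂ} {c : ℂ} {r : ℝ} (hr : 0 < r)
    (hF : ∀ z ∈ closedBall c r, DifferentiableAt ℂ F z) (L : ℂ →L[ℝ] ℝ) :
    CircleIntegrable (fun z => L (F z)) c r ∧ circleAverage (fun z => L (F z)) c r = L (F c) := by
  have hc : ContinuousOn F (closedBall c r) :=
    fun z hz => (hF z hz).continuousAt.continuousWithinAt
  have hi : CircleIntegrable F c r :=
    (hc.mono sphere_subset_closedBall).circleIntegrable hr.le
  have hi2 : CircleIntegrable (fun z => L (F z)) c r :=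
    (L.continuous.comp_continuousOn (hc.mono sphere_subset_closedBall)).circleIntegrable hr.le
  refine ⟨hi2, ?_⟩
  have h1 : circleAverage F c r = F c := by
    apply circleAverage_of_differentiable_on_off_countable (s := ∅) countable_empty
    · rwa [abs_of_pos hr]
    · rw [abs_of_pos hr]
      exact fun z hz => hF z (ball_subset_closedBall hz.1)
  rw [← h1]
  exact L.circleAverage_comp_comm hi

lemma aux_arctan_arg (w : ℂ) (h : 0 < w.re) : Real.arctan (w.im / w.re) = (Complex.log w).im := by
  rw [Complex.log_im, ← Complex.tan_arg]
  have := abs_lt.1 (Complex.abs_arg_lt_pi_div_two_iff.2 (Or.inl h))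
  exact Real.arctan_tan this.1 this.2

lemma aux_mean_arctan (A B c : ℂ) (r : ℝ) (hr : 0 < r)
    (h : ∀ ζ ∈ closedBall c r, 0 < (A + ζ * B).re) :
    CircleIntegrable (fun ζ => Real.arctan ((A + ζ * B).im / (A + ζ * B).re)) c r ∧
    circleAverage (fun ζ => Real.arctan ((A + ζ * B).im / (A + ζ * B).re)) c r
      = Real.arctan ((A + c * B).im / (A + c * B).re) := by
  have key := aux_mean_re (F := fun ζ => Complex.log (A + ζ * B)) hr (fun z hz => by
    have : A + z * B ∈ Complex.slitPlane := Or.inl (h z hz)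
    fun_prop (disch := exact this)) Complex.imCLM
  have he : Set.EqOn (fun ζ => Real.arctan ((A + ζ * B).im / (A + ζ * B).re))
      (fun ζ => Complex.imCLM (Complex.log (A + ζ * B))) (closedBall c r) :=
    fun z hz => aux_arctan_arg _ (h z hz)
  have he' := he.mono (sphere_subset_closedBall)
  rw [show Real.arctan ((A + c * B).im / (A + c * B).re) = _ from he (mem_closedBall_self hr.le)]
  rw [← abs_of_pos hr] at he'
  refine ⟨?_, ?_⟩
  · exact (circleIntegrable_congr he').2 key.1
  · rw [circleAverage_congr_sphere he']
    exact key.2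

/-- One-dimensional maximum principle. -/
lemma aux_max_principle (S : Set ℂ) (hS : IsOpen S) (R : ℝ) (hR : ∀ z ∈ S, ‖z‖ ≤ R)
    (f h : ℂ → ℝ) (hf : UpperSemicontinuousOn f S) (hh : ContinuousOn h S)
    (hpos : ∀ z ∈ S, 0 ≤ h z)
    (hsub : ∀ c r, 0 < r → closedBall c r ⊆ S → f c ≤ circleAverage f c r)
    (hmean : ∀ c r, 0 < r → closedBall c r ⊆ S →
      CircleIntegrable h c r ∧ circleAverage h c r = h c)
    (hbd : ∀ z ∈ frontier S, ∀ ε > 0, ∀ᶠ w in 𝓝[S] z, f w < h w + ε) :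
    ∀ z ∈ S, f z ≤ h z := by
  intro z₀ hz₀
  by_contra! hlt
  set e := f z₀ - h z₀ with he
  have hepos : 0 < e := by linarith
  set δ := e / (2 * (R ^ 2 + 1)) with hδ
  have hδpos : 0 < δ := by positivity
  have hδR : ∀ z ∈ S, δ * ‖z‖ ^ 2 < e / 2 := by
    intro z hz
    have h1 : ‖z‖ ^ 2 ≤ R ^ 2 := pow_le_pow_left₀ (norm_nonneg _) (hR z hz) 2
    have h2 : δ * (R ^ 2 + 1) = e / 2 := by rw [hδ]; field_simp
    nlinarith
  set φ : ℂ → ℝ := fun z => f z + (-h z + δ * ‖z‖ ^ 2) with hφ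
  have hφu : UpperSemicontinuousOn φ S :=
    hf.add (ContinuousOn.upperSemicontinuousOn (by fun_prop))
  set K := {z | z ∈ S ∧ e ≤ φ z} with hK
  have hKS : K ⊆ S := fun z hz => hz.1
  have hKc : IsClosed K := by
    rw [← closure_subset_iff_isClosed]
    intro z hz
    have hzS : z ∈ closure S := closure_mono hKS hz
    have hfr : ∃ᶠ w in 𝓝[S] z, e ≤ φ w := by
      rw [mem_closure_iff_frequently] at hz
      rw [frequently_nhdsWithin_iff]
      exact hz.mono fun w hw => ⟨hw.2, hw.1⟩
    by_cases hzin : z ∈ S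
    · refine ⟨hzin, ?_⟩
      by_contra! hlt'
      exact hfr ((hφu z hzin e hlt').mono fun w hw => not_le.2 hw)
    · exfalso
      have hzf : z ∈ frontier S := by
        rw [hS.frontier_eq]; exact ⟨hzS, hzin⟩
      refine hfr ?_
      filter_upwards [hbd z hzf (e / 2) (by positivity), self_mem_nhdsWithin] with w hw hwS
      have := hδR w hwS
      simp only [hφ]; linarith
  have hKb : IsCompact K := by
    refine Metric.isCompact_of_isClosed_isBounded hKc ?_
    refine (isBounded_closedBall (x := (0:ℂ)) (r := R)).subset fun z hz => ?_
    simpa using hR z hz.1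
  have hz₀K : z₀ ∈ K := ⟨hz₀, by
    have : 0 ≤ δ * ‖z₀‖ ^ 2 := by positivity
    simp only [hφ]; linarith⟩
  obtain ⟨c, hcK, hcmax⟩ := (hφu.mono hKS).exists_isMaxOn ⟨z₀, hz₀K⟩ hKb
  have hmaxS : ∀ z ∈ S, φ z ≤ φ c := by
    intro z hz
    by_cases hzK : z ∈ K
    · exact hcmax hzK
    · have : φ z < e := by
        by_contra! hcon
        exact hzK ⟨hz, hcon⟩
      exact this.le.trans hcK.2
  obtain ⟨r, hr, hrS⟩ := Metric.nhds_basis_closedBall.mem_iff.1 (hS.mem_nhds hcK.1)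
  have hs := hsub c r hr hrS
  obtain ⟨hm1, hm2⟩ := hmean c r hr hrS
  by_cases hfi : CircleIntegrable f c r
  · -- quadratic part
    have hq := aux_mean_re (F := fun z => (‖c‖ ^ 2 : ℝ) + 2 * (starRingEnd ℂ c) * (z - c)) (c := c)
      hr (fun z _ => by fun_prop) Complex.reCLM
    set Q : ℂ → ℝ := fun z => Complex.reCLM ((‖c‖ ^ 2 : ℝ) + 2 * (starRingEnd ℂ c) * (z - c))
      with hQ
    have hQc : Q c = ‖c‖ ^ 2 := by
      simp [hQ, -Complex.ofReal_pow]
    have hQs : ∀ z ∈ sphere c r, ‖z‖ ^ 2 = Q z + r ^ 2 := by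
      intro z hz
      have h1 : ‖z - c‖ = r := by simpa [dist_eq_norm] using hz
      rw [← h1]
      simp only [hQ, ← Complex.normSq_eq_norm_sq, Complex.normSq_apply, Complex.reCLM_apply]
      simp
      ring
    have hqi : CircleIntegrable (fun z => (-δ) • Q z) c r := by
      exact hq.1.const_smul
    have hle : circleAverage f c r ≤
        circleAverage (fun z => (φ c - δ * r ^ 2) + (h z + (-δ) • Q z)) c r := by
      apply circleAverage_mono hfi
      · exact (circleIntegrable_const _ _ _).add (hm1.add hqi)
      · intro z hz
        rw [abs_of_pos hr] at hz
        have h1 := hmaxS z (hrS (sphere_subset_closedBall hz))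
        have h2 : φ z = f z + (-h z + δ * (Q z + r ^ 2)) := by
          simp only [hφ]; rw [hQs z hz]
        simp only [smul_eq_mul]
        linarith
    have hval : circleAverage (fun z => (φ c - δ * r ^ 2) + (h z + (-δ) • Q z)) c r
        = (φ c - δ * r ^ 2) + (h c + (-δ) * Q c) := by
      have e1 := circleAverage_add (circleIntegrable_const (φ c - δ * r ^ 2) c r) (hm1.add hqi)
      have e2 := circleAverage_add hm1 hqi
      have e3 := circleAverage_smul (a := -δ) (f := Q) (c := c) (R := r)
      have e4 : circleAverage (fun z => (-δ) • Q z) c r = (-δ) * Q c := by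
        have : circleAverage Q c r = Q c := hq.2
        rw [← this]; exact e3
      have e5 : circleAverage (fun _ => φ c - δ * r ^ 2) c r = φ c - δ * r ^ 2 :=
        circleAverage_const _ _ _
      rw [e4, hm2] at e2
      rw [e2, e5] at e1
      exact e1
    rw [hval, hQc] at hle
    have : φ c = f c + (-h c + δ * ‖c‖ ^ 2) := rfl
    have : 0 < δ * r ^ 2 := by positivity
    linarith
  · rw [circleAverage.integral_undef hfi] at hs
    have h1 := hδR c hcK.1
    have h2 := hcK.2
    have h3 := hpos c hcK.1
    have : φ c = f c + (-h c + δ * ‖c‖ ^ 2) := rfl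
    linarith

end aux1

section aux2
open Real Topology

lemma aux_mink_nonneg (D : Set (Fin n → ℝ)) (x y : Fin n → ℝ) : 0 ≤ mink n D x y :=
  Real.sInf_nonneg fun _ ht => ht.1.le

lemma aux_mink_le {D : Set (Fin n → ℝ)} {x y : Fin n → ℝ} {t : ℝ} (ht : 0 < t)
    (h : x + t⁻¹ • y ∈ D) : mink n D x y ≤ t :=
  csInf_le ⟨0, fun _ hs => hs.1.le⟩ ⟨ht, h⟩

lemma aux_mink_nonempty {D : Set (Fin n → ℝ)} {x : Fin n → ℝ} (hD : IsOpen D) (hx : x ∈ D)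
    (y : Fin n → ℝ) : {t : ℝ | 0 < t ∧ x + t⁻¹ • y ∈ D}.Nonempty := by
  have h1 : Tendsto (fun t : ℝ => x + t⁻¹ • y) atTop (𝓝 (x + (0:ℝ) • y)) :=
    tendsto_const_nhds.add (tendsto_inv_atTop_zero.smul_const y)
  have h2 : ∀ᶠ t : ℝ in atTop, x + t⁻¹ • y ∈ D :=
    h1.eventually (hD.mem_nhds (by simpa using hx))
  obtain ⟨t, ht1, ht2⟩ := (h2.and (eventually_gt_atTop 0)).exists
  exact ⟨t, ht2, ht1⟩

lemma aux_mem_of_mink_lt {D : Set (Fin n → ℝ)} {x y : Fin n → ℝ} (hD : IsOpen D)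
    (hc : Convex ℝ D) (hx : x ∈ D) {t : ℝ} (ht : mink n D x y < t) : x + t⁻¹ • y ∈ D := by
  obtain ⟨s, ⟨hs0, hs⟩, hst⟩ := exists_lt_of_csInf_lt (aux_mink_nonempty n hD hx y) ht
  have ht0 : 0 < t := hs0.trans hst
  have := hc hx hs (a := 1 - s / t) (b := s / t)
    (by rw [sub_nonneg, div_le_one ht0]; exact hst.le) (by positivity) (by ring)
  convert this using 1
  ext i
  simp
  field_simp
  ring

lemma aux_mink_le_norm {D : Set (Fin n → ℝ)} {x y : Fin n → ℝ} {δ : ℝ} (hδ : 0 < δ)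
    (hb : ball x δ ⊆ D) : mink n D x y ≤ ‖y‖ / δ := by
  refine le_of_forall_gt_imp_ge_of_dense fun t ht => ?_
  have ht0 : 0 < t := lt_of_le_of_lt (by positivity) ht
  refine aux_mink_le n ht0 (hb ?_)
  rw [mem_ball, dist_eq_norm, add_sub_cancel_left, norm_smul, Real.norm_of_nonneg (by positivity)]
  rw [div_lt_iff₀ hδ] at ht
  rw [inv_mul_lt_iff₀ ht0]
  exact ht

lemma aux_mink_lip {D : Set (Fin n → ℝ)} {x y x' y' : Fin n → ℝ} {δ : ℝ} (hD : IsOpen D)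
    (hc : Convex ℝ D) (hx : x ∈ D) (hδ : 0 < δ) (hb : ball x' δ ⊆ D) :
    mink n D x' y' ≤ mink n D x y + (mink n D x y * ‖x' - x‖ + ‖y' - y‖) / δ := by
  have key : ∀ t, mink n D x y < t →
      mink n D x' y' ≤ t + (t * ‖x' - x‖ + ‖y' - y‖) / δ := by
    intro t ht
    have ht0 : 0 < t := (aux_mink_nonneg n D x y).trans_lt ht
    have hmem := aux_mem_of_mink_lt n hD hc hx ht
    refine le_of_forall_gt_imp_ge_of_dense fun τ hτ => ?_
    set s := τ - t with hs
    have hs1 : (t * ‖x' - x‖ + ‖y' - y‖) / δ < s := by linarith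
    have hs0 : 0 < s := lt_of_le_of_lt (by positivity) hs1
    have hτ0 : 0 < τ := by linarith
    refine aux_mink_le n hτ0 ?_
    have he : x' + s⁻¹ • (t • (x' - x) + (y' - y)) ∈ D := by
      apply hb
      rw [mem_ball, dist_eq_norm, add_sub_cancel_left, norm_smul,
        Real.norm_of_nonneg (by positivity), inv_mul_lt_iff₀ hs0]
      rw [div_lt_iff₀ hδ] at hs1
      refine lt_of_le_of_lt (norm_add_le _ _) ?_
      rwa [norm_smul, Real.norm_of_nonneg ht0.le]
    have := hc hmem he (a := t / τ) (b := s / τ) (by positivity) (by positivity)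
      (by rw [hs]; field_simp; ring)
    convert this using 1
    have hτs : τ = t + s := by rw [hs]; ring
    have hts : t + s ≠ 0 := by positivity
    rw [hτs]
    ext i
    simp
    field_simp
    ring
  have hcont : ContinuousWithinAt (fun t => t + (t * ‖x' - x‖ + ‖y' - y‖) / δ)
      (Ioi (mink n D x y)) (mink n D x y) := by
    apply Continuous.continuousWithinAt; fun_prop
  refine ge_of_tendsto hcont ?_
  filter_upwards [self_mem_nhdsWithin] with t ht using key t ht

lemma aux_mink_pos {D : Set (Fin n → ℝ)} {x y : Fin n → ℝ} (hD : IsOpen D)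
    (hb : Bornology.IsBounded D) (hx : x ∈ D) (hy : y ≠ 0) : 0 < mink n D x y := by
  obtain ⟨R, hR⟩ := hb.exists_norm_le
  have hR0 : 0 ≤ R := (norm_nonneg _).trans (hR x hx)
  have hy0 : 0 < ‖y‖ := norm_pos_iff.2 hy
  have : ‖y‖ / (2 * R + 1) ≤ mink n D x y := by
    refine le_csInf (aux_mink_nonempty n hD hx y) ?_
    rintro t ⟨ht0, ht⟩
    have h1 : ‖t⁻¹ • y‖ ≤ 2 * R := by
      calc ‖t⁻¹ • y‖ = ‖(x + t⁻¹ • y) - x‖ := by rw [add_sub_cancel_left]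
        _ ≤ _ := norm_sub_le _ _
        _ ≤ 2 * R := by linarith [hR _ ht, hR _ hx]
    rw [norm_smul, Real.norm_of_nonneg (by positivity), inv_mul_le_iff₀ ht0] at h1
    rw [div_le_iff₀ (by positivity)]
    nlinarith
  refine lt_of_lt_of_le ?_ this
  positivity

lemma aux_mink_zero {D : Set (Fin n → ℝ)} {x : Fin n → ℝ} (hx : x ∈ D) : mink n D x 0 = 0 := by
  refine le_antisymm ?_ (aux_mink_nonneg n D x 0)
  refine le_of_forall_gt_imp_ge_of_dense fun t ht => ?_
  exact aux_mink_le n ht (by simpa using hx)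

/-- supporting functional -/
lemma aux_support {D : Set (Fin n → ℝ)} {x y : Fin n → ℝ} (hD : IsOpen D)
    (hc : Convex ℝ D) (hp : 0 < mink n D x y) :
    ∃ (l : (Fin n → ℝ) →L[ℝ] ℝ) (C : ℝ), (∀ d ∈ D, l d < C) ∧
      l y = mink n D x y * (C - l x) := by
  set p := mink n D x y with hpdef
  have hnot : x + p⁻¹ • y ∉ D := by
    intro hmem
    have h1 : ContinuousAt (fun t : ℝ => x + t⁻¹ • y) p := by
      have := hp.ne'
      fun_prop (disch := assumption)
    have h2 : ∀ᶠ t in 𝓝 p, x + t⁻¹ • y ∈ D := h1.eventually (hD.mem_nhds hmem)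
    have h3 : ∀ᶠ t in 𝓝 p, 0 < t := eventually_gt_nhds hp
    obtain ⟨t, ⟨ht1, ht2⟩, ht3⟩ :=
      (((h2.and h3).filter_mono nhdsWithin_le_nhds).and
        (self_mem_nhdsWithin : Iio p ∈ 𝓝[<] p)).exists
    have := aux_mink_le n ht2 ht1
    exact absurd ht3 (not_lt.2 this)
  obtain ⟨l, hl⟩ := geometric_hahn_banach_open_point hc hD hnot
  refine ⟨l, l (x + p⁻¹ • y), hl, ?_⟩
  simp
  field_simp

lemma aux_support_le {D : Set (Fin n → ℝ)} {x : Fin n → ℝ} (hD : IsOpen D)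
    (hx : x ∈ D) (l : (Fin n → ℝ) →L[ℝ] ℝ) (C : ℝ) (hl : ∀ d ∈ D, l d < C) (y : Fin n → ℝ) :
    l y / (C - l x) ≤ mink n D x y := by
  refine le_csInf (aux_mink_nonempty n hD hx y) ?_
  rintro t ⟨ht0, ht⟩
  have h1 := hl _ ht
  have h2 := hl _ hx
  rw [div_le_iff₀ (by linarith)]
  simp at h1
  have : t * (t⁻¹ * l y) = l y := by field_simp
  nlinarith

lemma aux_seg {D : Set (Fin n → ℝ)} {x y : Fin n → ℝ} (hD : IsOpen D)
    (hc : Convex ℝ D) (hx : x ∈ D) (hp : 0 < mink n D x y) (hq : 0 < mink n D x (-y))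
    {s : ℝ} (h1 : s < (mink n D x y)⁻¹) (h2 : -(mink n D x (-y))⁻¹ < s) : x + s • y ∈ D := by
  rcases lt_trichotomy s 0 with h | h | h
  · have := aux_mem_of_mink_lt n hD hc hx (y := -y) (t := (-s)⁻¹) (by
      rw [lt_inv_comm₀ hq (by linarith)]; linarith)
    simpa using this
  · simpa [h] using hx
  · have := aux_mem_of_mink_lt n hD hc hx (y := y) (t := s⁻¹) (by
      rw [lt_inv_comm₀ hp h]; linarith)
    simpa using this

lemma aux_seg_conv {D : Set (Fin n → ℝ)} {x y : Fin n → ℝ} (hD : IsOpen D)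
    (hc : Convex ℝ D) (hx : x ∈ D) (hp : 0 < mink n D x y)
    {s : ℝ} (h : x + s • y ∈ D) : s < (mink n D x y)⁻¹ := by
  obtain ⟨l, C, hl, he⟩ := aux_support n hD hc hp
  have h1 := hl _ h
  have h2 := hl _ hx
  simp [he] at h1
  rw [inv_eq_one_div, lt_div_iff₀ hp]
  by_contra! hcon
  nlinarith

lemma aux_slice {D : Set (Fin n → ℝ)} {x y : Fin n → ℝ} (hD : IsOpen D)
    (hc : Convex ℝ D) (hx : x ∈ D) (hp : 0 < mink n D x y) (hq : 0 < mink n D x (-y))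
    {s t : ℝ} (h1 : s < (mink n D x y)⁻¹) (h2 : -(mink n D x (-y))⁻¹ < s) (ht : 0 < t) :
    mink n D (x + s • y) (t • y) ≤ t / ((mink n D x y)⁻¹ - s) := by
  refine le_of_forall_gt_imp_ge_of_dense fun τ hτ => ?_
  have ha : 0 < (mink n D x y)⁻¹ - s := by linarith
  have hτ0 : 0 < τ := lt_of_le_of_lt (by positivity) hτ
  refine aux_mink_le n hτ0 ?_
  rw [add_assoc, smul_smul, ← add_smul]
  have h3 : τ⁻¹ * t < (mink n D x y)⁻¹ - s := by
    rw [div_lt_iff₀ ha] at hτ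
    rw [inv_mul_lt_iff₀ hτ0]; exact hτ
  have h4 : 0 < τ⁻¹ * t := by positivity
  exact aux_seg n hD hc hx hp hq (by linarith) (by linarith)

end aux2

section aux3
open Real Topology

lemma aux_rePart_line (a b : Fin n → ℂ) (ζ : ℂ) :
    rePart n (a + ζ • b) = rePart n a + (ζ.re • rePart n b - ζ.im • imPart n b) := by
  ext i; simp [rePart, imPart]

lemma aux_imPart_line (a b : Fin n → ℂ) (ζ : ℂ) :
    imPart n (a + ζ • b) = imPart n a + (ζ.re • imPart n b + ζ.im • rePart n b) := by
  ext i; simp [rePart, imPart]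

lemma aux_rePart_real (x y : Fin n → ℝ) (ζ : ℂ) :
    rePart n (reC n x + ζ • reC n y) = x + ζ.re • y := by
  ext i; simp [rePart, reC]

lemma aux_imPart_real (x y : Fin n → ℝ) (ζ : ℂ) :
    imPart n (reC n x + ζ • reC n y) = ζ.im • y := by
  ext i; simp [imPart, reC]

lemma aux_decomp (z : Fin n → ℂ) :
    z = reC n (rePart n z) + Complex.I • reC n (imPart n z) := by
  ext i
  simp only [rePart, imPart, reC, Pi.add_apply, Pi.smul_apply, smul_eq_mul]
  rw [mul_comm]
  exact (Complex.re_add_im (z i)).symm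

lemma aux_minkP_conj (D : Set (Fin n → ℝ)) (z : Fin n → ℂ) :
    minkP n D (conjC n z) = mink n D (rePart n z) (-imPart n z) := by
  unfold minkP
  congr 1

lemma aux_arctan_lip (a b : ℝ) : |Real.arctan a - Real.arctan b| ≤ |a - b| := by
  have : LipschitzWith 1 Real.arctan := by
    apply lipschitzWith_of_nnnorm_deriv_le Real.differentiable_arctan
    intro x
    rw [Real.deriv_arctan, ← NNReal.coe_le_coe, coe_nnnorm, Real.norm_of_nonneg (by positivity)]
    rw [NNReal.coe_one, div_le_one (by positivity)]
    nlinarith [sq_nonneg x]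
  simpa [Real.dist_eq] using this.dist_le_mul a b

lemma aux_mink_loc_lip {D : Set (Fin n → ℝ)} {x₀ : Fin n → ℝ} (hD : IsOpen D)
    (hc : Convex ℝ D) (hx : x₀ ∈ D) (y₀ : Fin n → ℝ) :
    ∃ K : ℝ, ∃ δ > 0, 0 ≤ K ∧ ∀ x₁ x₂ y₁ y₂ : Fin n → ℝ, ∀ M : ℝ, ‖x₁ - x₀‖ < δ → ‖x₂ - x₀‖ < δ →
      ‖y₁ - y₀‖ < δ → ‖y₂ - y₀‖ < δ → ‖x₁ - x₂‖ ≤ M → ‖y₁ - y₂‖ ≤ M →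
      |mink n D x₁ y₁ - mink n D x₂ y₂| ≤ K * M := by
  obtain ⟨r, hr, hrD⟩ := Metric.isOpen_iff.1 hD x₀ hx
  set δ := r / 2 with hδ
  have hδ0 : 0 < δ := by positivity
  refine ⟨((‖y₀‖ + δ) / δ + 1) / δ, δ, hδ0, by positivity, ?_⟩
  have hball : ∀ x, ‖x - x₀‖ < δ → ball x δ ⊆ D := by
    intro x hx
    refine Subset.trans (ball_subset_ball' ?_) hrD
    rw [dist_eq_norm]; linarith
  have one : ∀ x₁ x₂ y₁ y₂ : Fin n → ℝ, ∀ M : ℝ, ‖x₁ - x₀‖ < δ → ‖x₂ - x₀‖ < δ →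
      ‖y₁ - y₀‖ < δ → ‖y₂ - y₀‖ < δ → ‖x₁ - x₂‖ ≤ M → ‖y₁ - y₂‖ ≤ M →
      mink n D x₁ y₁ - mink n D x₂ y₂ ≤ ((‖y₀‖ + δ) / δ + 1) / δ * M := by
    intro x₁ x₂ y₁ y₂ M hx₁ hx₂ hy₁ hy₂ hM1 hM2
    have h1 := aux_mink_lip n (y := y₂) (y' := y₁) hD hc (hball x₂ hx₂ (mem_ball_self hδ0)) hδ0
      (hball x₁ hx₁)
    have h2 : mink n D x₂ y₂ ≤ (‖y₀‖ + δ) / δ := by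
      refine (aux_mink_le_norm n hδ0 (hball x₂ hx₂)).trans ?_
      gcongr
      have := norm_le_norm_add_norm_sub' y₂ y₀
      linarith
    have h0 := aux_mink_nonneg n D x₂ y₂
    have h3 : (mink n D x₂ y₂ * ‖x₁ - x₂‖ + ‖y₁ - y₂‖) / δ ≤
        ((‖y₀‖ + δ) / δ * M + M) / δ := by
      gcongr
    calc mink n D x₁ y₁ - mink n D x₂ y₂ ≤ ((‖y₀‖ + δ) / δ * M + M) / δ := by linarith
      _ = _ := by ring
  intro x₁ x₂ y₁ y₂ M hx₁ hx₂ hy₁ hy₂ hM1 hM2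
  rw [abs_le]
  constructor
  · have := one x₂ x₁ y₂ y₁ M hx₂ hx₁ hy₂ hy₁ (by rwa [norm_sub_rev]) (by rwa [norm_sub_rev])
    linarith
  · exact one x₁ x₂ y₁ y₂ M hx₁ hx₂ hy₁ hy₂ hM1 hM2

lemma aux_rePart_norm (z w : Fin n → ℂ) : ‖rePart n z - rePart n w‖ ≤ ‖z - w‖ := by
  rw [pi_norm_le_iff_of_nonneg (norm_nonneg _)]
  intro i
  refine le_trans ?_ (norm_le_pi_norm (z - w) i)
  simpa [rePart] using Complex.abs_re_le_norm (z i - w i)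

lemma aux_imPart_norm (z w : Fin n → ℂ) : ‖imPart n z - imPart n w‖ ≤ ‖z - w‖ := by
  rw [pi_norm_le_iff_of_nonneg (norm_nonneg _)]
  intro i
  refine le_trans ?_ (norm_le_pi_norm (z - w) i)
  simpa [imPart] using Complex.abs_im_le_norm (z i - w i)

lemma aux_minkP_lip {D : Set (Fin n → ℝ)} (hD : IsOpen D)
    (hc : Convex ℝ D) (z : Fin n → ℂ) (hz : rePart n z ∈ D) :
    ∃ (K : NNReal) (U : Set (Fin n → ℂ)), U ∈ 𝓝 z ∧
      LipschitzOnWith K (fun z => Real.arctan (minkP n D z)) U ∧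
      LipschitzOnWith K (fun z => Real.arctan (minkP n D (conjC n z))) U := by
  obtain ⟨K₁, δ₁, hδ₁, hK₁, H₁⟩ := aux_mink_loc_lip n hD hc hz (imPart n z)
  obtain ⟨K₂, δ₂, hδ₂, hK₂, H₂⟩ := aux_mink_loc_lip n hD hc hz (-imPart n z)
  refine ⟨⟨max K₁ K₂, le_max_of_le_left hK₁⟩, ball z (min δ₁ δ₂),
    ball_mem_nhds _ (lt_min hδ₁ hδ₂), ?_, ?_⟩
  · refine LipschitzOnWith.of_dist_le_mul fun a ha b hb => ?_
    rw [mem_ball, dist_eq_norm, lt_min_iff] at ha hb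
    rw [Real.dist_eq, dist_eq_norm]
    refine (aux_arctan_lip _ _).trans ((H₁ _ _ _ _ ‖a - b‖ ?_ ?_ ?_ ?_ ?_ ?_).trans ?_)
    · exact (aux_rePart_norm n _ _).trans_lt ha.1
    · exact (aux_rePart_norm n _ _).trans_lt hb.1
    · exact (aux_imPart_norm n _ _).trans_lt ha.1
    · exact (aux_imPart_norm n _ _).trans_lt hb.1
    · exact aux_rePart_norm n _ _
    · exact aux_imPart_norm n _ _
    · exact mul_le_mul_of_nonneg_right (le_max_left _ _) (norm_nonneg _)
  · refine LipschitzOnWith.of_dist_le_mul fun a ha b hb => ?_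
    rw [mem_ball, dist_eq_norm, lt_min_iff] at ha hb
    rw [Real.dist_eq, dist_eq_norm, aux_minkP_conj, aux_minkP_conj]
    have hn : ∀ a b : Fin n → ℂ, ‖-imPart n a - -imPart n b‖ ≤ ‖a - b‖ := fun a b => by
      rw [neg_sub_neg, norm_sub_rev]; exact aux_imPart_norm n a b
    refine (aux_arctan_lip _ _).trans ((H₂ _ _ _ _ ‖a - b‖ ?_ ?_ ?_ ?_ ?_ ?_).trans ?_)
    · exact (aux_rePart_norm n _ _).trans_lt ha.2
    · exact (aux_rePart_norm n _ _).trans_lt hb.2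
    · exact (hn _ _).trans_lt ha.2
    · exact (hn _ _).trans_lt hb.2
    · exact aux_rePart_norm n _ _
    · exact hn _ _
    · exact mul_le_mul_of_nonneg_right (le_max_right _ _) (norm_nonneg _)

lemma aux_cont {D : Set (Fin n → ℝ)} (hD : IsOpen D)
    (hc : Convex ℝ D) (z : Fin n → ℂ) (hz : rePart n z ∈ D) :
    ContinuousAt (fun z => Real.arctan (minkP n D z)) z ∧
    ContinuousAt (fun z => Real.arctan (minkP n D (conjC n z))) z := by
  obtain ⟨K, U, hU, h1, h2⟩ := aux_minkP_lip n hD hc z hz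
  exact ⟨h1.continuousOn.continuousAt hU, h2.continuousOn.continuousAt hU⟩

lemma aux_U_lip {D : Set (Fin n → ℝ)} (hD : IsOpen D)
    (hc : Convex ℝ D) (z : Fin n → ℂ) (hz : rePart n z ∈ D) :
    ∃ (K : NNReal) (U : Set (Fin n → ℂ)), U ∈ 𝓝 z ∧ LipschitzOnWith K (ellTubeU n D) U := by
  obtain ⟨K, U, hU, h1, h2⟩ := aux_minkP_lip n hD hc z hz
  refine ⟨K, U, hU, LipschitzOnWith.of_dist_le_mul fun a ha b hb => ?_⟩
  have e1 := h1.dist_le_mul a ha b hb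
  have e2 := h2.dist_le_mul a ha b hb
  rw [Real.dist_eq, abs_le] at e1 e2 ⊢
  unfold ellTubeU
  constructor <;> linarith [e1.1, e1.2, e2.1, e2.2]

lemma aux_U_cont {D : Set (Fin n → ℝ)} (hD : IsOpen D)
    (hc : Convex ℝ D) (z : Fin n → ℂ) (hz : rePart n z ∈ D) : ContinuousAt (ellTubeU n D) z := by
  obtain ⟨K, U, hU, h1⟩ := aux_U_lip n hD hc z hz
  exact h1.continuousOn.continuousAt hU

lemma aux_U_nonneg (D : Set (Fin n → ℝ)) (z : Fin n → ℂ) : 0 ≤ ellTubeU n D z := by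
  have h1 : 0 ≤ Real.arctan (minkP n D z) := Real.arctan_nonneg.2 (aux_mink_nonneg n _ _ _)
  have h2 : 0 ≤ Real.arctan (minkP n D (conjC n z)) :=
    Real.arctan_nonneg.2 (aux_mink_nonneg n _ _ _)
  unfold ellTubeU
  linarith

lemma aux_U_lt (D : Set (Fin n → ℝ)) (z : Fin n → ℂ) (hz : z ∈ ellTube n D) :
    ellTubeU n D z < Real.pi / 4 := by
  have := Real.arctan_add_arctan_lt_pi_div_two hz.2
  unfold ellTubeU
  linarith

lemma aux_U_zero_of {D : Set (Fin n → ℝ)} (z : Fin n → ℂ) (hz : rePart n z ∈ D)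
    (h : imPart n z = 0) : ellTubeU n D z = 0 := by
  unfold ellTubeU
  rw [aux_minkP_conj]
  unfold minkP
  rw [h, neg_zero, aux_mink_zero n hz]
  simp

lemma aux_U_zero {D : Set (Fin n → ℝ)} (hD : IsOpen D) (hb : Bornology.IsBounded D)
    (z : Fin n → ℂ) (hz : rePart n z ∈ D) : ellTubeU n D z = 0 ↔ imPart n z = 0 := by
  refine ⟨fun h => ?_, aux_U_zero_of n z hz⟩
  by_contra hne
  have h1 : 0 < Real.arctan (minkP n D z) := Real.arctan_pos.2 (aux_mink_pos n hD hb hz hne)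
  have h2 : 0 ≤ Real.arctan (minkP n D (conjC n z)) :=
    Real.arctan_nonneg.2 (aux_mink_nonneg n _ _ _)
  unfold ellTubeU at h
  linarith

/-- mean value for the functions attached to supporting hyperplanes -/
lemma aux_support_mean (l : (Fin n → ℝ) →L[ℝ] ℝ) (C : ℝ) (a b : Fin n → ℂ) (c : ℂ) (r : ℝ)
    (hr : 0 < r) (h : ∀ ζ ∈ closedBall c r, l (rePart n (a + ζ • b)) < C) :
    let H : ℂ → ℝ := fun ζ => Real.arctan (l (-imPart n (a + ζ • b)) /
      (C - l (rePart n (a + ζ • b))))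
    CircleIntegrable H c r ∧ circleAverage H c r = H c := by
  intro H
  set A : ℂ := ⟨C - l (rePart n a), -l (imPart n a)⟩ with hA
  set B : ℂ := ⟨-l (rePart n b), -l (imPart n b)⟩ with hB
  have hre : ∀ ζ : ℂ, (A + ζ * B).re = C - l (rePart n (a + ζ • b)) := by
    intro ζ
    rw [aux_rePart_line]
    simp [hA, hB]
    ring
  have him : ∀ ζ : ℂ, (A + ζ * B).im = l (-imPart n (a + ζ • b)) := by
    intro ζ
    rw [aux_imPart_line]
    simp [hA, hB]
    ring
  have := aux_mean_arctan A B c r hr (fun ζ hζ => by rw [hre]; linarith [h ζ hζ])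
  simp only [hre, him] at this
  exact this

lemma aux_submean {D : Set (Fin n → ℝ)} (hD : IsOpen D) (hc : Convex ℝ D)
    (a b : Fin n → ℂ) (c : ℂ) (r : ℝ) (hr : 0 < r)
    (h : ∀ ζ ∈ closedBall c r, rePart n (a + ζ • b) ∈ D) (σ : ℝ) (hσ : σ = 1 ∨ σ = -1)
    (F : (Fin n → ℂ) → ℝ)
    (hF : ∀ z, F z = Real.arctan (mink n D (rePart n z) (σ • imPart n z)))
    (hFc : ∀ z, rePart n z ∈ D → ContinuousAt F z) :
    CircleIntegrable (fun ζ => F (a + ζ • b)) c r ∧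
    F (a + c • b) ≤ circleAverage (fun ζ => F (a + ζ • b)) c r := by
  have hi : CircleIntegrable (fun ζ => F (a + ζ • b)) c r := by
    apply ContinuousOn.circleIntegrable hr.le
    intro ζ hζ
    refine ContinuousAt.continuousWithinAt ?_
    exact ContinuousAt.comp (f := fun ζ : ℂ => a + ζ • b)
      (hFc _ (h ζ (sphere_subset_closedBall hζ))) (by fun_prop)
  refine ⟨hi, ?_⟩
  have hcD := h c (mem_closedBall_self hr.le)
  have hnn : ∀ z, 0 ≤ F z := fun z => by
    rw [hF]; exact Real.arctan_nonneg.2 (aux_mink_nonneg n _ _ _)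
  rcases (aux_mink_nonneg n D (rePart n (a + c • b)) (σ • imPart n (a + c • b))).eq_or_lt
    with h0 | h0
  · rw [hF, ← h0, Real.arctan_zero]
    exact circleAverage_nonneg_of_nonneg fun z _ => hnn _
  · obtain ⟨l, C, hl, he⟩ := aux_support n hD hc h0
    obtain ⟨m1, m2⟩ := aux_support_mean n l C a b c r hr (fun ζ hζ => hl _ (h ζ hζ))
    set H : ℂ → ℝ := fun ζ => Real.arctan (l (-imPart n (a + ζ • b)) /
      (C - l (rePart n (a + ζ • b)))) with hH
    have hlow : ∀ z, rePart n z ∈ D →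
        Real.arctan (l (σ • imPart n z) / (C - l (rePart n z))) ≤ F z := by
      intro z hz
      rw [hF]
      exact Real.arctan_mono (aux_support_le n hD hz l C hl _)
    have hsig : ∀ ζ : ℂ, Real.arctan (l (σ • imPart n (a + ζ • b)) /
        (C - l (rePart n (a + ζ • b)))) = (-σ) • H ζ := by
      intro ζ
      simp only [hH]
      rcases hσ with rfl | rfl
      · simp [neg_div, Real.arctan_neg]
      · simp
    have hval : F (a + c • b) = (-σ) • H c := by
      rw [← hsig, hF, he]
      have : 0 < C - l (rePart n (a + c • b)) := by linarith [hl _ hcD]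
      congr 1
      field_simp
    have m3 : circleAverage (fun ζ => (-σ) • H ζ) c r = (-σ) • H c := by
      rw [← m2]; exact circleAverage_smul (a := -σ) (f := H) (c := c) (R := r)
    rw [hval, ← m3]
    apply circleAverage_mono m1.const_smul hi
    intro ζ hζ
    rw [abs_of_pos hr] at hζ
    show (-σ) • H ζ ≤ _
    rw [← hsig]
    exact hlow _ (h ζ (sphere_subset_closedBall hζ))

lemma aux_U_psh {D : Set (Fin n → ℝ)} (hD : IsOpen D) (hc : Convex ℝ D) :
    PlurisubharmonicOn n (ellTubeU n D) (ellTube n D) := by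
  constructor
  · apply ContinuousOn.upperSemicontinuousOn
    exact fun z hz => (aux_U_cont n hD hc z hz.1).continuousWithinAt
  · intro a b c r hr h
    have h1 := aux_submean n hD hc a b c r hr (fun ζ hζ => (h ζ hζ).1) 1 (Or.inl rfl)
      (fun z => Real.arctan (minkP n D z)) (fun z => by simp [minkP])
      (fun z hz => (aux_cont n hD hc z hz).1)
    have h2 := aux_submean n hD hc a b c r hr (fun ζ hζ => (h ζ hζ).1) (-1) (Or.inr rfl)
      (fun z => Real.arctan (minkP n D (conjC n z))) (fun z => by simp [aux_minkP_conj])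
      (fun z hz => (aux_cont n hD hc z hz).2)
    have h3 := circleAverage_add h1.1 h2.1
    have h4 : circleAverage (fun ζ => ellTubeU n D (a + ζ • b)) c r =
        (1 / 2 : ℝ) • circleAverage ((fun ζ => Real.arctan (minkP n D (a + ζ • b))) +
          (fun ζ => Real.arctan (minkP n D (conjC n (a + ζ • b))))) c r := by
      rw [← circleAverage_smul]
      congr 1
      ext ζ
      simp [ellTubeU]
      ring
    have h5 : ellTubeU n D (a + c • b) ≤ circleAverage (fun ζ => ellTubeU n D (a + ζ • b)) c r := by
      rw [h4, h3]
      have e1 := h1.2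
      have e2 := h2.2
      simp only [smul_eq_mul, ellTubeU] at *
      linarith
    exact h5

end aux3

section aux4
open Real Topology

/-- The harmonic comparison function on a slice. -/
noncomputable def auxH (a b : ℝ) (ζ : ℂ) : ℝ :=
  (Real.arctan (ζ.im / (b + ζ.re)) + Real.arctan (ζ.im / (a - ζ.re))) / 2

lemma auxH_cont (a b : ℝ) (ζ : ℂ) (h1 : -b < ζ.re) (h2 : ζ.re < a) : ContinuousAt (auxH a b) ζ := by
  have e1 : b + ζ.re ≠ 0 := by linarith
  have e2 : a - ζ.re ≠ 0 := by linarith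
  have c1 : ContinuousAt (fun ζ : ℂ => ζ.im / (b + ζ.re)) ζ :=
    Complex.continuous_im.continuousAt.div
      (continuousAt_const.add Complex.continuous_re.continuousAt) e1
  have c2 : ContinuousAt (fun ζ : ℂ => ζ.im / (a - ζ.re)) ζ :=
    Complex.continuous_im.continuousAt.div
      (continuousAt_const.sub Complex.continuous_re.continuousAt) e2
  exact ((Real.continuous_arctan.continuousAt.comp c1).add
    (Real.continuous_arctan.continuousAt.comp c2)).div_const 2

lemma auxH_nonneg (a b : ℝ) (ζ : ℂ) (h1 : -b ≤ ζ.re) (h2 : ζ.re ≤ a) (h3 : 0 ≤ ζ.im) :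
    0 ≤ auxH a b ζ := by
  have e1 : 0 ≤ Real.arctan (ζ.im / (b + ζ.re)) :=
    Real.arctan_nonneg.2 (div_nonneg h3 (by linarith))
  have e2 : 0 ≤ Real.arctan (ζ.im / (a - ζ.re)) :=
    Real.arctan_nonneg.2 (div_nonneg h3 (by linarith))
  unfold auxH; linarith

lemma auxH_mean (a b : ℝ) (c : ℂ) (r : ℝ) (hr : 0 < r)
    (h : ∀ ζ ∈ closedBall c r, -b < ζ.re ∧ ζ.re < a) :
    CircleIntegrable (auxH a b) c r ∧ circleAverage (auxH a b) c r = auxH a b c := by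
  have k1 := aux_mean_arctan b 1 c r hr (fun ζ hζ => by simp; linarith [(h ζ hζ).1])
  have k2 := aux_mean_arctan a (-1) c r hr (fun ζ hζ => by simp; linarith [(h ζ hζ).2])
  have hfun : auxH a b = (1 / 2 : ℝ) •
      ((fun ζ : ℂ => Real.arctan ((b + ζ * 1).im / (b + ζ * 1).re)) -
      (fun ζ : ℂ => Real.arctan ((a + ζ * (-1)).im / (a + ζ * (-1)).re))) := by
    ext ζ
    simp [auxH, neg_div, Real.arctan_neg, sub_eq_add_neg]
    ring
  have hv : auxH a b c = (1 / 2 : ℝ) • (Real.arctan ((b + c * 1).im / (b + c * 1).re) -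
      Real.arctan ((a + c * (-1)).im / (a + c * (-1)).re)) := by
    rw [hfun]; rfl
  constructor
  · rw [hfun]
    exact (k1.1.sub k2.1).const_smul
  · rw [hv, ← k1.2, ← k2.2, ← circleAverage_sub k1.1 k2.1, ← circleAverage_smul, ← hfun]

lemma aux_U_le {D : Set (Fin n → ℝ)} {x y : Fin n → ℝ} (hD : IsOpen D)
    (hc : Convex ℝ D) (hx : x ∈ D) (hp : 0 < mink n D x y) (hq : 0 < mink n D x (-y))
    (ζ : ℂ) (h1 : ζ.re < (mink n D x y)⁻¹) (h2 : -(mink n D x (-y))⁻¹ < ζ.re) (ht : 0 < ζ.im) :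
    minkP n D (reC n x + ζ • reC n y) ≤ ζ.im / ((mink n D x y)⁻¹ - ζ.re) ∧
    minkP n D (conjC n (reC n x + ζ • reC n y)) ≤ ζ.im / ((mink n D x (-y))⁻¹ + ζ.re) ∧
    ellTubeU n D (reC n x + ζ • reC n y) ≤ auxH (mink n D x y)⁻¹ (mink n D x (-y))⁻¹ ζ := by
  have e1 : minkP n D (reC n x + ζ • reC n y) ≤ ζ.im / ((mink n D x y)⁻¹ - ζ.re) := by
    unfold minkP
    rw [aux_rePart_real, aux_imPart_real]
    exact aux_slice n hD hc hx hp hq h1 h2 ht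
  have e2 : minkP n D (conjC n (reC n x + ζ • reC n y)) ≤
      ζ.im / ((mink n D x (-y))⁻¹ + ζ.re) := by
    rw [aux_minkP_conj, aux_rePart_real, aux_imPart_real]
    have := aux_slice n (x := x) (y := -y) (s := -ζ.re) (t := ζ.im) hD hc hx hq
      (by rwa [neg_neg]) (by linarith) (by rw [neg_neg]; linarith) ht
    simpa using this
  refine ⟨e1, e2, ?_⟩
  have f1 := Real.arctan_mono e1
  have f2 := Real.arctan_mono e2
  unfold ellTubeU auxH
  linarith

lemma aux_line_cont (x y : Fin n → ℝ) : Continuous (fun ζ : ℂ => reC n x + ζ • reC n y) := by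
  fun_prop

lemma aux_U_at {D : Set (Fin n → ℝ)} (z : Fin n → ℂ) :
    ellTubeU n D z = auxH (mink n D (rePart n z) (imPart n z))⁻¹
      (mink n D (rePart n z) (-imPart n z))⁻¹ Complex.I := by
  unfold ellTubeU auxH
  rw [aux_minkP_conj]
  simp [minkP]
  ring

/-- Maximality. -/
lemma aux_maximal {D : Set (Fin n → ℝ)} (hD : IsOpen D) (hc : Convex ℝ D)
    (hb : Bornology.IsBounded D) (w : (Fin n → ℂ) → ℝ) (hw : MemPSHU n (ellTube n D) w)
    (z : Fin n → ℂ) (hz : z ∈ ellTube n D) : w z ≤ ellTubeU n D z := by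
  obtain ⟨⟨husc, hsub⟩, hrange, hreal⟩ := hw
  set x := rePart n z with hxdef
  set y := imPart n z with hydef
  have hzxy : z = reC n x + Complex.I • reC n y := aux_decomp n z
  have hx : x ∈ D := hz.1
  by_cases hy : y = 0
  · have : z = reC n x := by rw [hzxy, hy]; ext i; simp [reC]
    rw [this, hreal x (this ▸ hz)]
    exact aux_U_nonneg n D _
  have hp : 0 < mink n D x y := aux_mink_pos n hD hb hx hy
  have hq : 0 < mink n D x (-y) := aux_mink_pos n hD hb hx (neg_ne_zero.2 hy)
  have hpq : mink n D x y * mink n D x (-y) < 1 := by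
    have := hz.2
    rwa [aux_minkP_conj] at this
  set a := (mink n D x y)⁻¹ with ha
  set b := (mink n D x (-y))⁻¹ with hbdef
  have ha0 : 0 < a := by positivity
  have hb0 : 0 < b := by positivity
  have hab : 1 < a * b := by
    rw [ha, hbdef, ← mul_inv]
    exact (one_lt_inv₀ (by positivity)).2 hpq
  -- the claim for smaller discs
  have key : ∀ a' b' : ℝ, 0 < a' → 0 < b' → a' < a → b' < b → 1 < a' * b' →
      w z ≤ auxH a' b' Complex.I := by
    intro a' b' ha' hb' haa hbb hab'
    set S : Set ℂ := {ζ | 0 < ζ.im ∧ ζ.im ^ 2 < (a' - ζ.re) * (b' + ζ.re) ∧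
      -b' < ζ.re ∧ ζ.re < a'} with hS
    have hSo : IsOpen S := by
      have c1 := Complex.continuous_re
      have c2 := Complex.continuous_im
      refine (isOpen_lt continuous_const c2).inter ((isOpen_lt
        (f := fun ζ : ℂ => ζ.im ^ 2) (g := fun ζ : ℂ => (a' - ζ.re) * (b' + ζ.re))
        (by fun_prop) (by fun_prop)).inter
        ((isOpen_lt continuous_const c1).inter (isOpen_lt c1 continuous_const)))
    have hScl : closure S ⊆ {ζ : ℂ | 0 ≤ ζ.im ∧ ζ.im ^ 2 ≤ (a' - ζ.re) * (b' + ζ.re) ∧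
      -b' ≤ ζ.re ∧ ζ.re ≤ a'} := by
      have c1 := Complex.continuous_re
      have c2 := Complex.continuous_im
      refine closure_minimal ?_ ?_
      · rintro ζ ⟨h1, h2, h3, h4⟩
        exact ⟨h1.le, h2.le, h3.le, h4.le⟩
      · exact (isClosed_le continuous_const c2).inter
          ((isClosed_le
          (f := fun ζ : ℂ => ζ.im ^ 2) (g := fun ζ : ℂ => (a' - ζ.re) * (b' + ζ.re))
          (by fun_prop) (by fun_prop)).inter
          ((isClosed_le continuous_const c1).inter (isClosed_le c1 continuous_const)))
    have hSt : ∀ ζ ∈ S, reC n x + ζ • reC n y ∈ ellTube n D := by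
      rintro ζ ⟨h1, h2, h3, h4⟩
      refine ⟨?_, ?_⟩
      · rw [aux_rePart_real]
        exact aux_seg n hD hc hx hp hq (by linarith) (by linarith)
      · obtain ⟨e1, e2, -⟩ := aux_U_le n hD hc hx hp hq ζ (by linarith) (by linarith) h1
        have d1 : 0 < a - ζ.re := by linarith
        have d2 : 0 < b + ζ.re := by linarith
        refine lt_of_le_of_lt (mul_le_mul e1 e2 (aux_mink_nonneg n _ _ _) (by positivity)) ?_
        rw [div_mul_div_comm, div_lt_one (by positivity)]
        have : (a' - ζ.re) * (b' + ζ.re) ≤ (a - ζ.re) * (b + ζ.re) :=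
          mul_le_mul (by linarith) (by linarith) (by linarith) d1.le
        nlinarith
    have hIS : Complex.I ∈ S := by
      simp [hS, ha', hb', hab']
    have hmp := aux_max_principle S hSo (a' + b' + (a' + b')) (fun ζ hζ => by
      obtain ⟨h1, h2, h3, h4⟩ := hζ
      have e1 : |ζ.re| ≤ a' + b' := by rw [abs_le]; constructor <;> linarith
      have e2 : |ζ.im| ≤ a' + b' := by
        apply abs_le_of_sq_le_sq _ (by positivity)
        nlinarith
      have := Complex.norm_le_abs_re_add_abs_im ζ
      linarith)
      (fun ζ => w (reC n x + ζ • reC n y)) (auxH a' b')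
      (fun ζ hζ t ht => by
        have := husc _ (hSt ζ hζ) t ht
        refine Tendsto.eventually ?_ this
        refine tendsto_nhdsWithin_of_tendsto_nhds_of_eventually_within _
          ((aux_line_cont n x y).continuousAt.tendsto.mono_left nhdsWithin_le_nhds) ?_
        filter_upwards [self_mem_nhdsWithin] with η hη using hSt η hη)
      (fun ζ hζ => (auxH_cont a' b' ζ hζ.2.2.1 hζ.2.2.2).continuousWithinAt)
      (fun ζ hζ => auxH_nonneg a' b' ζ hζ.2.2.1.le hζ.2.2.2.le hζ.1.le)
      (fun c r hr hcr => hsub (reC n x) (reC n y) c r hr (fun ζ hζ => hSt ζ (hcr hζ)))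
      (fun c r hr hcr => auxH_mean a' b' c r hr (fun ζ hζ => (hcr hζ).2.2))
      (fun ζ hζ ε hε => by
        rw [hSo.frontier_eq] at hζ
        obtain ⟨h1, h2, h3, h4⟩ := hScl hζ.1
        rcases h1.eq_or_lt with h0 | h0
        · -- real boundary point
          have hrp : reC n x + ζ • reC n y = reC n (x + ζ.re • y) := by
            have : ζ = (ζ.re : ℂ) := by
              apply Complex.ext
              · simp
              · simp [← h0]
            ext i
            simp only [reC, Pi.add_apply, Pi.smul_apply, smul_eq_mul, Complex.ofReal_add,
              Complex.ofReal_mul]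
            rw [← this]
          have hmemD : x + ζ.re • y ∈ D :=
            aux_seg n hD hc hx hp hq (by linarith) (by linarith)
          have hmem : reC n x + ζ • reC n y ∈ ellTube n D := by
            refine ⟨by rwa [aux_rePart_real], ?_⟩
            unfold minkP
            rw [aux_rePart_real, aux_imPart_real, ← h0, zero_smul, aux_mink_zero n hmemD]
            simp
          have hw0 : w (reC n x + ζ • reC n y) = 0 := by
            rw [hrp]; apply hreal; rw [← hrp]; exact hmem
          have hev := husc _ hmem ε (by show w _ < ε; rw [hw0]; exact hε)
          have htend : Tendsto (fun η : ℂ => reC n x + η • reC n y) (𝓝[S] ζ)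
              (𝓝[ellTube n D] (reC n x + ζ • reC n y)) := by
            refine tendsto_nhdsWithin_of_tendsto_nhds_of_eventually_within _
              ((aux_line_cont n x y).continuousAt.tendsto.mono_left nhdsWithin_le_nhds) ?_
            filter_upwards [self_mem_nhdsWithin] with η hη using hSt η hη
          filter_upwards [htend.eventually hev, self_mem_nhdsWithin] with η hη hηS
          have := auxH_nonneg a' b' η hηS.2.2.1.le hηS.2.2.2.le hηS.1.le
          linarith
        · have hpos : 0 < (a' - ζ.re) * (b' + ζ.re) := lt_of_lt_of_le (by positivity) h2
          have h5 : ζ.re < a' := lt_of_le_of_ne h4 (fun h => by simp [h] at hpos)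
          have h6 : -b' < ζ.re := lt_of_le_of_ne h3 (fun h => by simp [← h] at hpos)
          have h7 : ζ.im ^ 2 = (a' - ζ.re) * (b' + ζ.re) := by
            refine le_antisymm h2 ?_
            by_contra! hcon
            exact hζ.2 ⟨h0, hcon, h6, h5⟩
          have d1 : 0 < a' - ζ.re := by linarith
          have d2 : 0 < b' + ζ.re := by linarith
          have hval : auxH a' b' ζ = Real.pi / 4 := by
            unfold auxH
            have : ζ.im / (b' + ζ.re) = (ζ.im / (a' - ζ.re))⁻¹ := by
              rw [inv_div, div_eq_div_iff d2.ne' h0.ne']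
              rw [← h7]; ring
            rw [this, Real.arctan_inv_of_pos (by positivity)]
            ring
          have hcts := (auxH_cont a' b' ζ h6 h5).eventually
            (eventually_gt_nhds (show Real.pi / 4 - ε < auxH a' b' ζ by rw [hval]; linarith))
          filter_upwards [hcts.filter_mono nhdsWithin_le_nhds, self_mem_nhdsWithin] with η hη hηS
          have := (hrange _ (hSt η hηS)).2
          linarith)
      Complex.I hIS
    rwa [← hzxy] at hmp
  -- pass to the limit
  have hU : ellTubeU n D z = auxH a b Complex.I := aux_U_at n z
  rw [hU]
  have hlim : Tendsto (fun ρ : ℝ => auxH (ρ * a) (ρ * b) Complex.I) (𝓝[<] 1)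
      (𝓝 (auxH a b Complex.I)) := by
    have hct : ContinuousAt (fun ρ : ℝ => auxH (ρ * a) (ρ * b) Complex.I) 1 := by
      unfold auxH
      simp only [Complex.I_im, Complex.I_re, add_zero, sub_zero]
      have c1 : ContinuousAt (fun ρ : ℝ => 1 / (ρ * b)) 1 :=
        continuousAt_const.div (by fun_prop) (by simpa using hb0.ne')
      have c2 : ContinuousAt (fun ρ : ℝ => 1 / (ρ * a)) 1 :=
        continuousAt_const.div (by fun_prop) (by simpa using ha0.ne')
      exact ((Real.continuous_arctan.continuousAt.comp c1).add
        (Real.continuous_arctan.continuousAt.comp c2)).div_const 2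
    have := hct.tendsto.mono_left (nhdsWithin_le_nhds (s := Iio (1:ℝ)))
    simpa using this
  refine ge_of_tendsto hlim ?_
  have ev1 : ∀ᶠ ρ : ℝ in 𝓝 1, 1 < (ρ * a) * (ρ * b) := by
    have : ContinuousAt (fun ρ : ℝ => (ρ * a) * (ρ * b)) 1 := by fun_prop
    exact this.eventually (eventually_gt_nhds (by simpa using hab))
  have ev2 : ∀ᶠ ρ : ℝ in 𝓝 1, 0 < ρ := eventually_gt_nhds one_pos
  filter_upwards [ev1.filter_mono nhdsWithin_le_nhds, ev2.filter_mono nhdsWithin_le_nhds,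
    self_mem_nhdsWithin] with ρ h1 h2 h3
  have h3' : ρ < 1 := h3
  exact key _ _ (by positivity) (by positivity) (by nlinarith) (by nlinarith) h1

lemma aux_MA {D : Set (Fin n → ℝ)} (hD : IsOpen D) (hc : Convex ℝ D)
    (hb : Bornology.IsBounded D) :
    MongeAmpereZeroOn n (ellTubeU n D) (ellTube n D \ {z : Fin n → ℂ | imPart n z = 0}) := by
  intro G hG hGcl hGc v hv hbd z hzG
  obtain ⟨husc, hsub⟩ := hv
  have hzt := hGcl (subset_closure hzG)
  set x := rePart n z with hxdef
  set y := imPart n z with hydef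
  have hzxy : z = reC n x + Complex.I • reC n y := aux_decomp n z
  have hx : x ∈ D := hzt.1.1
  have hy : y ≠ 0 := hzt.2
  have hp : 0 < mink n D x y := aux_mink_pos n hD hb hx hy
  have hq : 0 < mink n D x (-y) := aux_mink_pos n hD hb hx (neg_ne_zero.2 hy)
  set a := (mink n D x y)⁻¹ with ha
  set b := (mink n D x (-y))⁻¹ with hbdef
  have hlc := aux_line_cont n x y
  set S : Set ℂ := {ζ | 0 < ζ.im ∧ reC n x + ζ • reC n y ∈ G} with hS
  have hSo : IsOpen S :=
    (isOpen_lt continuous_const Complex.continuous_im).inter (hG.preimage hlc)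
  have hSG : ∀ ζ ∈ S, reC n x + ζ • reC n y ∈ G := fun ζ hζ => hζ.2
  -- points of the closure
  have hcl : ∀ ζ : ℂ, reC n x + ζ • reC n y ∈ closure G → -b < ζ.re ∧ ζ.re < a ∧ ζ.im ≠ 0 := by
    intro ζ hζ
    obtain ⟨h1, h2⟩ := hGcl hζ
    have h3 := h1.1
    rw [aux_rePart_real] at h3
    refine ⟨?_, aux_seg_conv n hD hc hx hp h3, ?_⟩
    · have := aux_seg_conv n (y := -y) (s := -ζ.re) hD hc hx hq (by simpa using h3)
      linarith
    · intro h0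
      apply h2
      show imPart n _ = 0
      rw [aux_imPart_real, h0, zero_smul]
  have hScl : ∀ ζ ∈ closure S, 0 < ζ.im ∧ reC n x + ζ • reC n y ∈ closure G := by
    intro ζ hζ
    have h1 : reC n x + ζ • reC n y ∈ closure G :=
      map_mem_closure (f := fun ζ : ℂ => reC n x + ζ • reC n y) hlc hζ hSG
    have h2 : 0 ≤ ζ.im := by
      have : closure S ⊆ {ζ : ℂ | 0 ≤ ζ.im} :=
        closure_minimal (fun ζ hζ => le_of_lt hζ.1)
          (isClosed_le continuous_const Complex.continuous_im)
      exact this hζ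
    exact ⟨lt_of_le_of_ne h2 (hcl ζ h1).2.2.symm, h1⟩
  have hSab : ∀ ζ ∈ closure S, -b < ζ.re ∧ ζ.re < a := fun ζ hζ =>
    ⟨(hcl ζ (hScl ζ hζ).2).1, (hcl ζ (hScl ζ hζ).2).2.1⟩
  have hUle : ∀ ζ ∈ closure S, ellTubeU n D (reC n x + ζ • reC n y) ≤ auxH a b ζ := fun ζ hζ =>
    (aux_U_le n hD hc hx hp hq ζ (hSab ζ hζ).2 (hSab ζ hζ).1 (hScl ζ hζ).1).2.2
  have hIS : Complex.I ∈ S := ⟨by simp, by rw [← hzxy]; exact hzG⟩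
  have hreCy : 0 < ‖reC n y‖ := by
    rw [norm_pos_iff]
    intro h
    apply hy
    ext i
    have := congrFun h i
    simpa [reC] using this
  obtain ⟨R, hR⟩ := hGc.isBounded.exists_norm_le
  have hmp := aux_max_principle S hSo ((R + ‖reC n x‖) / ‖reC n y‖) (fun ζ hζ => by
      rw [le_div_iff₀ hreCy, ← norm_smul]
      have h1 := hR _ (subset_closure (hSG ζ hζ))
      have h2 : ζ • reC n y = (reC n x + ζ • reC n y) - reC n x := by abel
      rw [h2]
      exact (norm_sub_le _ _).trans (by linarith))
    (fun ζ => v (reC n x + ζ • reC n y)) (auxH a b)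
    (fun ζ hζ t ht => by
      have := husc _ (hSG ζ hζ) t ht
      refine Tendsto.eventually ?_ this
      refine tendsto_nhdsWithin_of_tendsto_nhds_of_eventually_within _
        (hlc.continuousAt.tendsto.mono_left nhdsWithin_le_nhds) ?_
      filter_upwards [self_mem_nhdsWithin] with η hη using hSG η hη)
    (fun ζ hζ => (auxH_cont a b ζ (hSab ζ (subset_closure hζ)).1
      (hSab ζ (subset_closure hζ)).2).continuousWithinAt)
    (fun ζ hζ => (aux_U_nonneg n D _).trans (hUle ζ (subset_closure hζ)))
    (fun c r hr hcr => hsub (reC n x) (reC n y) c r hr (fun ζ hζ => hSG ζ (hcr hζ)))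
    (fun c r hr hcr => auxH_mean a b c r hr (fun ζ hζ => hSab ζ (subset_closure (hcr hζ))))
    (fun ζ hζ ε hε => by
      rw [hSo.frontier_eq] at hζ
      obtain ⟨hζc, hζn⟩ := hζ
      obtain ⟨h1, h2⟩ := hScl ζ hζc
      have hfr : reC n x + ζ • reC n y ∈ frontier G := by
        rw [hG.frontier_eq]
        exact ⟨h2, fun h => hζn ⟨h1, h⟩⟩
      have hlim := hbd _ hfr
      have hlt : limsup (fun x => (v x : EReal)) (𝓝[G] (reC n x + ζ • reC n y)) <
          ((auxH a b ζ + ε / 2 : ℝ) : EReal) := by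
        refine lt_of_le_of_lt hlim ?_
        rw [EReal.coe_lt_coe_iff]
        linarith [hUle ζ hζc]
      have hev := eventually_lt_of_limsup_lt hlt
      have htend : Tendsto (fun η : ℂ => reC n x + η • reC n y) (𝓝[S] ζ)
          (𝓝[G] (reC n x + ζ • reC n y)) := by
        refine tendsto_nhdsWithin_of_tendsto_nhds_of_eventually_within _
          (hlc.continuousAt.tendsto.mono_left nhdsWithin_le_nhds) ?_
        filter_upwards [self_mem_nhdsWithin] with η hη using hSG η hη
      have hcts := (auxH_cont a b ζ (hSab ζ hζc).1 (hSab ζ hζc).2).eventually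
        (eventually_gt_nhds (show auxH a b ζ - ε / 2 < auxH a b ζ by linarith))
      filter_upwards [htend.eventually hev, hcts.filter_mono nhdsWithin_le_nhds] with η h3 h4
      rw [EReal.coe_lt_coe_iff] at h3
      linarith)
    Complex.I hIS
  rw [aux_U_at n z]
  rwa [← hzxy] at hmp

end aux4

/-- **Theorem 7.1** (main part).  Let `D ⊆ ℝⁿ` be a bounded open convex domain,
`D^ell` the elliptic tube over `D` and `u(z) = (arctan p(z) + arctan p(z̄))/2`.  Then
`u` is locally Lipschitz on `D^ell`; `u(x+iy) = 0` iff `y = 0`; `u` is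
plurisubharmonic on `D^ell`; `u` is the maximal element of `𝒰(D, D^ell)`; and
`(dd^c u)^n = 0` on `D^ell ∖ D`. -/
theorem ellTube_maximal
    (D : Set (Fin n → ℝ)) (hDne : D.Nonempty) (hDopen : IsOpen D)
    (hDconv : Convex ℝ D) (hDbdd : Bornology.IsBounded D) :
    (∀ z ∈ ellTube n D, ∃ (K : NNReal) (U : Set (Fin n → ℂ)), U ∈ nhds z ∧
        LipschitzOnWith K (ellTubeU n D) (U ∩ ellTube n D)) ∧
      (∀ z ∈ ellTube n D, (ellTubeU n D z = 0 ↔ imPart n z = 0)) ∧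
      PlurisubharmonicOn n (ellTubeU n D) (ellTube n D) ∧
      MemPSHU n (ellTube n D) (ellTubeU n D) ∧
      (∀ w : (Fin n → ℂ) → ℝ, MemPSHU n (ellTube n D) w →
        ∀ z ∈ ellTube n D, w z ≤ ellTubeU n D z) ∧
      MongeAmpereZeroOn n (ellTubeU n D)
        (ellTube n D \ {z : Fin n → ℂ | imPart n z = 0}) := by
  have hpsh := aux_U_psh n hDopen hDconv
  refine ⟨fun z hz => ?_, fun z hz => aux_U_zero n hDopen hDbdd z hz.1, hpsh,
    ⟨hpsh, fun z hz => ⟨aux_U_nonneg n D z, aux_U_lt n D z hz⟩, fun x hx => ?_⟩,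
    fun w hw z hz => aux_maximal n hDopen hDconv hDbdd w hw z hz,
    aux_MA n hDopen hDconv hDbdd⟩
  · obtain ⟨K, U, hU, h⟩ := aux_U_lip n hDopen hDconv z hz.1
    exact ⟨K, U, hU, h.mono inter_subset_left⟩
  · apply aux_U_zero_of n _ hx.1
    ext i
    simp [imPart, reC]
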